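/- Let Γ be a discrete, torsion-free subgroup of SL(2,ℝ) not containing −1, let u ∈ SL(2,ℝ), and suppose there is a sequence (γ_n)_{n≥0} of hyperbolic elements of Γ such that for every n the axis Axis(γ_n) meets the geodesic ray {u • (eᵗ i) : t ≥ 0}, and ℓ(γ_n) → 0. Then there exists an uncountable set V ⊆ SL(2,ℝ) such that: (a) every w ∈ V satisfies lim_{t→+∞} ⨅_{γ ∈ Γ} d₁( u * A(t), γ * (w * A(t)) ) = 0 (every w ∈ V lies in the strong stable set W^{ss}(u)), and (b) distinct elements of V lie on distinct horocyclic orbits in the quotient: for all w, w' ∈ V with w ≠ w', for all γ ∈ Γ, s ∈ ℝ and ε ∈ {1, −1}, w' ≠ ε • (γ * w * N(s)). In particular W^{ss}(u) is an uncountable union of horocyclic orbits. -/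

import Mathlib

open UpperHalfPlane Matrix Real Filter Topology
open scoped MatrixGroups

noncomputable section

namespace BellisFormal

/-- The point `eᵗ i` of the upper half-plane. -/
def vray (t : ℝ) : ℍ := ⟨⟨0, Real.exp t⟩, Real.exp_pos t⟩

/-- Translation length of `γ`. -/
def transLength (γ : SL(2, ℝ)) : ℝ := ⨅ z : ℍ, dist z (γ • z)

/-- `γ` is hyperbolic: `|tr γ| > 2`. -/
def IsHyperbolic (γ : SL(2, ℝ)) : Prop :=
  2 < |Matrix.trace (γ : Matrix (Fin 2) (Fin 2) ℝ)|

/-- Axis of `γ`. -/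
def Axis (γ : SL(2, ℝ)) : Set ℍ := {z : ℍ | dist z (γ • z) = transLength γ}

/-- `x` is a real fixed point of the Möbius map of `γ`. -/
def IsFixedPt (γ : SL(2, ℝ)) (x : ℝ) : Prop :=
  γ 1 0 * x ^ 2 + (γ 1 1 - γ 0 0) * x - γ 0 1 = 0

def IsAttractingFixedPt (γ : SL(2, ℝ)) (x : ℝ) : Prop :=
  IsFixedPt γ x ∧ 1 < (γ 1 0 * x + γ 1 1) ^ 2

def IsRepellingFixedPt (γ : SL(2, ℝ)) (x : ℝ) : Prop :=
  IsFixedPt γ x ∧ (γ 1 0 * x + γ 1 1) ^ 2 < 1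

instance : TopologicalSpace SL(2, ℝ) :=
  TopologicalSpace.induced (fun g => (g : Matrix (Fin 2) (Fin 2) ℝ)) inferInstance

structure IsNestedSequence (γ : ℕ → SL(2, ℝ)) (γp γm : ℕ → ℝ) (t : ℕ → ℝ) : Prop where
  hyperbolic : ∀ n, IsHyperbolic (γ n)
  discrete : DiscreteTopology (Subgroup.closure (Set.range γ) : Subgroup SL(2, ℝ))
  attracting : ∀ n, IsAttractingFixedPt (γ n) (γp n)
  repelling : ∀ n, IsRepellingFixedPt (γ n) (γm n)
  plus_pos : ∀ n, 0 < γp n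
  plus_mono : StrictMono γp
  minus_neg : ∀ n, γm n < 0
  minus_anti : StrictAnti γm
  t_pos : ∀ n, 0 < t n
  axis_meets : ∀ n, ∀ s : ℝ, 0 ≤ s → (vray s ∈ Axis (γ n) ↔ s = t n)
  len_anti : StrictAnti fun n => transLength (γ n)
  len_tendsto : Filter.Tendsto (fun n => transLength (γ n)) Filter.atTop (nhds 0)

/-- geodesic flow matrix -/
def A (t : ℝ) : SL(2, ℝ) :=
  ⟨!![Real.exp (t / 2), 0; 0, Real.exp (-(t / 2))], by
    simp [Matrix.det_fin_two_of, ← Real.exp_add]⟩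

/-- horocyclic flow matrix -/
def N (s : ℝ) : SL(2, ℝ) :=
  ⟨!![1, s; 0, 1], by simp [Matrix.det_fin_two_of]⟩

/-- the distance `d₁` between unit tangent vectors encoded as elements of `SL(2,ℝ)` -/
def d1 (g h : SL(2, ℝ)) : ℝ :=
  dist (g • vray 0) (h • vray 0) + dist (g • vray 1) (h • vray 1)

/-- product `α 0 * α 1 * ⋯ * α n` -/
def seqProd (α : ℕ → SL(2, ℝ)) (n : ℕ) : SL(2, ℝ) :=
  ((List.range (n + 1)).map α).prod


/-- the point `a + y i` of the upper half-plane -/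
def mkPt (a y : ℝ) (hy : 0 < y) : ℍ := ⟨⟨a, y⟩, hy⟩

/-- the Busemann cocycle values `r_n = B_∞(β_n⁻¹ • i, i)` -/
def busR (α : ℕ → SL(2, ℝ)) (n : ℕ) : ℝ :=
  - Real.log (((seqProd α n)⁻¹ • UpperHalfPlane.I).im)


set_option maxHeartbeats 2000000 in
lemma step_lemma (P : Subgroup SL(2, ℝ))
    (H : ∀ ε > 0, ∀ T : ℝ, ∃ g ∈ P, ∃ t ≥ T, (g 0 0, g 1 0) ≠ ((1, 0) : ℝ × ℝ) ∧
      |g 0 0 - 1| ≤ ε ∧ |g 1 0| * rexp t ≤ ε ∧ |g 0 1| ≤ ε * rexp t ∧ |g 1 1 - 1| ≤ ε)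
    (v : ℝ × ℝ) (e : ℝ) (he : 0 < e) (β : SL(2, ℝ)) (hβ : β ∈ P) (t r : ℝ) (hr : 0 < r) :
    ∃ β' ∈ P, ∃ t' r' : ℝ, t + 1 ≤ t' ∧ 0 < r' ∧
      Metric.closedBall ((β' 0 0, β' 1 0) : ℝ × ℝ) r' ⊆ Metric.closedBall (β 0 0, β 1 0) r ∧
      v ∉ Metric.closedBall ((β' 0 0, β' 1 0) : ℝ × ℝ) r' ∧
      (∀ x ∈ Metric.closedBall ((β' 0 0, β' 1 0) : ℝ × ℝ) r',
        |β 1 1 * x.1 - β 0 1 * x.2 - 1| ≤ e ∧ |- β 1 0 * x.1 + β 0 0 * x.2| * rexp t' ≤ e) ∧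
      |β' 1 1| ≤ e * rexp t' ∧ |β' 0 1| ≤ e * rexp t' := by
  obtain ⟨a, ha⟩ : ∃ a, a = β 0 0 := ⟨_, rfl⟩
  obtain ⟨b, hb⟩ : ∃ a, a = β 0 1 := ⟨_, rfl⟩
  obtain ⟨c, hc⟩ : ∃ a, a = β 1 0 := ⟨_, rfl⟩
  obtain ⟨d, hd⟩ : ∃ a, a = β 1 1 := ⟨_, rfl⟩
  have hdet : a * d - b * c = 1 := by
    have := β.det_coe
    rw [Matrix.det_fin_two] at this
    rw [ha, hb, hc, hd]; exact this
  obtain ⟨C, hC1, hCa, hCb, hCc, hCd⟩ :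
      ∃ C : ℝ, 1 ≤ C ∧ |a| ≤ C ∧ |b| ≤ C ∧ |c| ≤ C ∧ |d| ≤ C :=
    ⟨1 + |a| + |b| + |c| + |d|, by have := abs_nonneg a; have := abs_nonneg b; have := abs_nonneg c; have := abs_nonneg d; linarith, by
      have := abs_nonneg b; have := abs_nonneg c; have := abs_nonneg d; linarith, by
      have := abs_nonneg a; have := abs_nonneg c; have := abs_nonneg d; linarith, by
      have := abs_nonneg b; have := abs_nonneg a; have := abs_nonneg d; linarith, by
      have := abs_nonneg b; have := abs_nonneg c; have := abs_nonneg a; linarith⟩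
  have hC0 : 0 < C := by linarith
  obtain ⟨ε, hε0, hε1, hεr, hεe, hεC⟩ : ∃ ε : ℝ, 0 < ε ∧ ε ≤ 1 ∧ 2 * C * ε ≤ r / 2 ∧
      ε ≤ e / 2 ∧ ε * C ≤ e / 2 := by
    refine ⟨min 1 (min (r / (4 * C)) (min (e / 2) (e / (2 * C)))), by positivity,
      min_le_left _ _, ?_, ?_, ?_⟩
    · have : min 1 (min (r / (4 * C)) (min (e / 2) (e / (2 * C)))) ≤ r / (4 * C) :=
        (min_le_right _ _).trans (min_le_left _ _)
      rw [le_div_iff₀ (by positivity)] at this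
      linarith
    · exact (min_le_right _ _).trans ((min_le_right _ _).trans (min_le_left _ _))
    · have : min 1 (min (r / (4 * C)) (min (e / 2) (e / (2 * C)))) ≤ e / (2 * C) :=
        (min_le_right _ _).trans ((min_le_right _ _).trans (min_le_right _ _))
      rw [le_div_iff₀ (by positivity)] at this
      linarith
  obtain ⟨g, hg, t', ht', hne, h00, h10, h01, h11⟩ :=
    H ε hε0 (max (t + 1) (max 0 (Real.log (4 * C / e))))
  have ht1 : t + 1 ≤ t' := (le_max_left _ _).trans ht'
  have ht0 : 0 ≤ t' := (le_max_left _ _).trans ((le_max_right _ _).trans ht')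
  have htC : 4 * C ≤ e * rexp t' := by
    have h := (le_max_right _ _).trans ((le_max_right _ _).trans ht')
    have h2 := Real.exp_le_exp.2 h
    rw [Real.exp_log (by positivity), div_le_iff₀ he] at h2
    linarith
  have hexp1 : 1 ≤ rexp t' := Real.one_le_exp ht0
  -- choose α = 1 or g
  obtain ⟨α, hα, hαv, h00, h10, h01, h11⟩ : ∃ α ∈ P,
      ((β * α) 0 0, (β * α) 1 0) ≠ v ∧
      |α 0 0 - 1| ≤ ε ∧ |α 1 0| * rexp t' ≤ ε ∧ |α 0 1| ≤ ε * rexp t' ∧ |α 1 1 - 1| ≤ ε := by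
    by_cases hv : ((β * 1) 0 0, (β * 1) 1 0) = v
    · refine ⟨g, hg, ?_, h00, h10, h01, h11⟩
      rw [← hv]
      intro h
      apply hne
      simp only [Matrix.SpecialLinearGroup.coe_mul, Matrix.mul_apply, Fin.sum_univ_two,
        Prod.mk.injEq, mul_one, ← ha, ← hb, ← hc, ← hd] at h ⊢
      obtain ⟨h1, h2⟩ := h
      constructor
      · linear_combination d * h1 - b * h2 + (1 - g 0 0) * hdet
      · linear_combination a * h2 - c * h1 - (g 1 0) * hdet
    · refine ⟨1, P.one_mem, hv, ?_, ?_, ?_, ?_⟩ <;> simp <;> positivity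
  have e00 : (β * α) 0 0 = a * α 0 0 + b * α 1 0 := by
    simp [Matrix.mul_apply, Fin.sum_univ_two, ha, hb]
  have e10 : (β * α) 1 0 = c * α 0 0 + d * α 1 0 := by
    simp [Matrix.mul_apply, Fin.sum_univ_two, hc, hd]
  have e01 : (β * α) 0 1 = a * α 0 1 + b * α 1 1 := by
    simp [Matrix.mul_apply, Fin.sum_univ_two, ha, hb]
  have e11 : (β * α) 1 1 = c * α 0 1 + d * α 1 1 := by
    simp [Matrix.mul_apply, Fin.sum_univ_two, hc, hd]
  have h10' : |α 1 0| ≤ ε := (le_mul_of_one_le_right (abs_nonneg _) hexp1).trans h10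
  refine ⟨β * α, P.mul_mem hβ hα, t', ?_⟩
  rw [← ha, ← hb, ← hc, ← hd]
  obtain ⟨x', hx'⟩ : ∃ x' : ℝ × ℝ, x' = ((β * α) 0 0, (β * α) 1 0) := ⟨_, rfl⟩
  rw [← hx'] at hαv ⊢
  have hx1 : x'.1 = a * α 0 0 + b * α 1 0 := by rw [hx', ← e00]
  have hx2 : x'.2 = c * α 0 0 + d * α 1 0 := by rw [hx', ← e10]
  have hdv : 0 < dist v x' := dist_pos.2 (Ne.symm hαv)
  obtain ⟨r', hr0, hr1, hr2, hr3⟩ : ∃ r' : ℝ, 0 < r' ∧ r' ≤ r / 2 ∧ r' < dist v x' ∧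
      2 * C * rexp t' * r' ≤ e / 2 := by
    refine ⟨min (r / 2) (min (dist v x' / 2) (e / (4 * C * rexp t'))), by positivity,
      min_le_left _ _, ?_, ?_⟩
    · refine lt_of_le_of_lt ((min_le_right _ _).trans (min_le_left _ _)) (by linarith)
    · have : min (r / 2) (min (dist v x' / 2) (e / (4 * C * rexp t'))) ≤ e / (4 * C * rexp t') :=
        (min_le_right _ _).trans (min_le_right _ _)
      rw [le_div_iff₀ (by positivity)] at this
      linarith
  have two : ∀ p q y z B : ℝ, |p| ≤ C → |q| ≤ C → |y| ≤ B → |z| ≤ B →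
      |p * y + q * z| ≤ 2 * C * B := by
    intro p q y z B hp hq hy hz
    calc |p * y + q * z| ≤ |p * y| + |q * z| := abs_add_le _ _
      _ = |p| * |y| + |q| * |z| := by rw [abs_mul, abs_mul]
      _ ≤ C * B + C * B := by gcongr
      _ = _ := by ring
  refine ⟨r', ht1, hr0, ?_, ?_, ?_, ?_, ?_⟩
  · apply Metric.closedBall_subset_closedBall'
    have : dist x' (a, c) ≤ 2 * C * ε := by
      rw [Prod.dist_eq, Real.dist_eq, Real.dist_eq, hx1, hx2]
      apply max_le
      · have := two a b (α 0 0 - 1) (α 1 0) ε hCa hCb h00 h10'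
        rw [show a * α 0 0 + b * α 1 0 - a = a * (α 0 0 - 1) + b * α 1 0 by ring]; exact this
      · have := two c d (α 0 0 - 1) (α 1 0) ε hCc hCd h00 h10'
        rw [show c * α 0 0 + d * α 1 0 - c = c * (α 0 0 - 1) + d * α 1 0 by ring]; exact this
    linarith
  · rw [Metric.mem_closedBall]; linarith
  · intro x hx
    rw [Metric.mem_closedBall, Prod.dist_eq, Real.dist_eq, Real.dist_eq] at hx
    have hx1' := (le_max_left _ _).trans hx
    have hx2' := (le_max_right _ _).trans hx
    have hnb : |-b| ≤ C := by rwa [abs_neg]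
    have hnc : |-c| ≤ C := by rwa [abs_neg]
    have k1 := two d (-b) _ _ r' hCd hnb hx1' hx2'
    have k2 := two (-c) a _ _ r' hnc hCa hx1' hx2'
    constructor
    · have : d * x.1 - b * x.2 - 1 = (d * (x.1 - x'.1) + -b * (x.2 - x'.2)) + (α 0 0 - 1) := by
        rw [hx1, hx2]; linear_combination (α 0 0) * hdet
      rw [this]
      refine (abs_add_le _ _).trans ?_
      have : 2 * C * r' ≤ 2 * C * rexp t' * r' := by
        have : 0 ≤ 2 * C * r' := by positivity
        nlinarith only [this, hexp1]
      linarith only [this, k1, h00, hr3, hεe]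
    · have : -c * x.1 + a * x.2 = (-c * (x.1 - x'.1) + a * (x.2 - x'.2)) + α 1 0 := by
        rw [hx1, hx2]; linear_combination (α 1 0) * hdet
      rw [this]
      have h3 := abs_add_le (-c * (x.1 - x'.1) + a * (x.2 - x'.2)) (α 1 0)
      have h4 := mul_le_mul_of_nonneg_right (h3.trans (add_le_add_left k2 _)) (Real.exp_pos t').le
      refine h4.trans ?_
      rw [add_mul]
      linarith only [h10, hεe, hr3]
  all_goals
    have hA : |α 1 1| ≤ 2 := by
      have := abs_le.1 h11
      rw [abs_le]; constructor <;> linarith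
    have fin : ∀ p q : ℝ, |p| ≤ C → |q| ≤ C → |p * α 0 1 + q * α 1 1| ≤ e * rexp t' := by
      intro p q hp hq
      calc |p * α 0 1 + q * α 1 1| ≤ |p * α 0 1| + |q * α 1 1| := abs_add_le _ _
        _ = |p| * |α 0 1| + |q| * |α 1 1| := by rw [abs_mul, abs_mul]
        _ ≤ C * (ε * rexp t') + C * 2 := by gcongr
        _ ≤ e * rexp t' := by
          have := mul_le_mul_of_nonneg_right hεC (Real.exp_pos t').le
          linarith only [this, htC]
  · rw [e11]; exact fin _ _ hCc hCd
  · rw [e01]; exact fin _ _ hCa hCb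

/-- `g` conjugated by the geodesic flow at time `t` is `ε`-close to the identity. -/
def Near (ε t : ℝ) (g : SL(2, ℝ)) : Prop :=
  |g 0 0 - 1| ≤ ε ∧ |g 1 0| * rexp t ≤ ε ∧ |g 0 1| ≤ ε * rexp t ∧ |g 1 1 - 1| ≤ ε

set_option maxHeartbeats 2000000 in
lemma core (P : Subgroup SL(2, ℝ))
    (H : ∀ ε > 0, ∀ T : ℝ, ∃ g ∈ P, ∃ t ≥ T, (g 0 0, g 1 0) ≠ ((1, 0) : ℝ × ℝ) ∧ Near ε t g)
    (v : ℕ → ℝ × ℝ) :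
    ∃ w : SL(2, ℝ), (∀ k, (w 0 0, w 1 0) ≠ v k) ∧
      ∀ ε > 0, ∃ T : ℝ, ∀ t ≥ T, ∃ δ ∈ P, Near ε t (δ * w) := by
  have hstep : ∀ (k : ℕ) (s : {s : SL(2, ℝ) × ℝ × ℝ // s.1 ∈ P ∧ 0 < s.2.2}),
      ∃ s' : {s : SL(2, ℝ) × ℝ × ℝ // s.1 ∈ P ∧ 0 < s.2.2},
      s.1.2.1 + 1 ≤ s'.1.2.1 ∧
      Metric.closedBall ((s'.1.1 0 0, s'.1.1 1 0) : ℝ × ℝ) s'.1.2.2 ⊆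
        Metric.closedBall (s.1.1 0 0, s.1.1 1 0) s.1.2.2 ∧
      v k ∉ Metric.closedBall ((s'.1.1 0 0, s'.1.1 1 0) : ℝ × ℝ) s'.1.2.2 ∧
      (∀ x ∈ Metric.closedBall ((s'.1.1 0 0, s'.1.1 1 0) : ℝ × ℝ) s'.1.2.2,
        |s.1.1 1 1 * x.1 - s.1.1 0 1 * x.2 - 1| ≤ 1 / ((k : ℝ) + 2) ∧
        |- s.1.1 1 0 * x.1 + s.1.1 0 0 * x.2| * rexp s'.1.2.1 ≤ 1 / ((k : ℝ) + 2)) ∧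
      |s'.1.1 1 1| ≤ 1 / ((k : ℝ) + 2) * rexp s'.1.2.1 ∧
      |s'.1.1 0 1| ≤ 1 / ((k : ℝ) + 2) * rexp s'.1.2.1 := by
    rintro k ⟨⟨β, t, r⟩, hβ, hr⟩
    obtain ⟨β', hβ', t', r', h1, h2, h3⟩ := step_lemma P H (v k) (1 / ((k : ℝ) + 2))
      (by positivity) β hβ t r hr
    exact ⟨⟨⟨β', t', r'⟩, hβ', h2⟩, h1, h3⟩
  choose F hF using hstep
  obtain ⟨S, hS⟩ : ∃ S : ℕ → {s : SL(2, ℝ) × ℝ × ℝ // s.1 ∈ P ∧ 0 < s.2.2},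
      ∀ k, S (k + 1) = F k (S k) :=
    ⟨fun n => Nat.rec ⟨⟨1, 0, 1⟩, P.one_mem, one_pos⟩ (fun k s => F k s) n, fun k => rfl⟩
  have hS' := fun k => hF k (S k)
  simp only [← hS] at hS'
  obtain ⟨β, hβ⟩ : ∃ β : ℕ → SL(2, ℝ), ∀ k, (S k).1.1 = β k := ⟨_, fun _ => rfl⟩
  obtain ⟨τ, hτ⟩ : ∃ τ : ℕ → ℝ, ∀ k, (S k).1.2.1 = τ k := ⟨_, fun _ => rfl⟩
  obtain ⟨r, hr⟩ : ∃ r : ℕ → ℝ, ∀ k, (S k).1.2.2 = r k := ⟨_, fun _ => rfl⟩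
  have hβP : ∀ k, β k ∈ P := fun k => hβ k ▸ (S k).2.1
  have hr0 : ∀ k, 0 < r k := fun k => hr k ▸ (S k).2.2
  simp only [hβ, hτ, hr] at hS'
  clear hβ hτ hr hS hF
  obtain ⟨x, hx⟩ := IsCompact.nonempty_iInter_of_sequence_nonempty_isCompact_isClosed
    (fun k => Metric.closedBall ((β k 0 0, β k 1 0) : ℝ × ℝ) (r k))
    (fun k => (hS' k).2.1) (fun k => ⟨_, Metric.mem_closedBall_self (hr0 k).le⟩)
    (isCompact_closedBall _ _) (fun k => Metric.isClosed_closedBall)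
  rw [Set.mem_iInter] at hx
  have hxn : 0 < x.1 ^ 2 + x.2 ^ 2 := by
    by_contra hcon
    have h1 : x.1 = 0 := by nlinarith [sq_nonneg x.1, sq_nonneg x.2]
    have h2 : x.2 = 0 := by nlinarith [sq_nonneg x.1, sq_nonneg x.2]
    have := ((hS' 0).2.2.2.1 x (hx 1)).1
    rw [h1, h2] at this
    norm_num at this
  obtain ⟨w, hw0, hw1⟩ : ∃ w : SL(2, ℝ), w 0 0 = x.1 ∧ w 1 0 = x.2 := by
    refine ⟨⟨!![x.1, -x.2 / (x.1 ^ 2 + x.2 ^ 2); x.2, x.1 / (x.1 ^ 2 + x.2 ^ 2)], ?_⟩, ?_, ?_⟩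
    · rw [Matrix.det_fin_two_of]; field_simp; ring
    · simp
    · simp
  refine ⟨w, ?_, ?_⟩
  · intro k hk
    apply (hS' k).2.2.1
    rw [← hk, hw0, hw1]
    exact hx (k + 1)
  intro ε hε
  obtain ⟨η, hη0, hη1, hη2⟩ : ∃ η : ℝ, 0 < η ∧ η ≤ 1 / 2 ∧ 4 * η ≤ ε :=
    ⟨min (1 / 2) (ε / 4), by positivity, min_le_left _ _, by
      have := min_le_right (1 / 2) (ε / 4); linarith⟩
  obtain ⟨Y, hY⟩ : ∃ Y, Y = 1 + |w 0 1| + |w 1 1| := ⟨_, rfl⟩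
  have hY0 : 1 ≤ Y := by
    have := abs_nonneg (w 0 1); have := abs_nonneg (w 1 1); linarith
  obtain ⟨K, hK⟩ := exists_nat_gt (Y / η)
  have hKK : ∀ k : ℕ, K ≤ k → Y * (1 / ((k : ℝ) + 2)) ≤ η := by
    intro k hk
    have : (K : ℝ) ≤ k := by exact_mod_cast hk
    rw [div_lt_iff₀ hη0] at hK
    rw [mul_one_div, div_le_iff₀ (by positivity)]
    nlinarith
  have hmono : StrictMono τ := strictMono_nat_of_lt_succ fun k => by
    have := (hS' k).1; linarith
  have hτk : ∀ k : ℕ, τ 0 + k ≤ τ k := by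
    intro k
    induction k with
    | zero => simp
    | succ k ih => have := (hS' k).1; push_cast; linarith
  refine ⟨τ (K + 1), fun t ht => ?_⟩
  have hex : ∃ m, t < τ m := by
    obtain ⟨m, hm⟩ := exists_nat_gt (t - τ 0)
    exact ⟨m, by have := hτk m; linarith⟩
  classical
  obtain ⟨m, hm, hmin⟩ : ∃ m, t < τ m ∧ ∀ n < m, τ n ≤ t :=
    ⟨Nat.find hex, Nat.find_spec hex, fun n hn => not_lt.1 (Nat.find_min hex hn)⟩
  have hmK : K + 1 < m := hmono.lt_iff_lt.1 (lt_of_le_of_lt ht hm)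
  obtain ⟨j, rfl⟩ : ∃ j, m = j + 2 := ⟨m - 2, by omega⟩
  have hjt : τ (j + 1) ≤ t := hmin _ (by omega)
  have hK1 := hKK j (by omega)
  have hK2 := hKK (j + 1) (by omega)
  obtain ⟨q1, q2⟩ := (hS' (j + 1)).2.2.2.1 x (hx (j + 2))
  have q3 := (hS' j).2.2.2.2.1
  have q4 := (hS' j).2.2.2.2.2
  obtain ⟨e1, he1⟩ : ∃ e1, e1 = 1 / ((j : ℝ) + 2) := ⟨_, rfl⟩
  obtain ⟨e2, he2⟩ : ∃ e1, e1 = 1 / (((j + 1 : ℕ) : ℝ) + 2) := ⟨_, rfl⟩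
  have he2p : 0 < e2 := by rw [he2]; positivity
  have he1p : 0 < e1 := by rw [he1]; positivity
  rw [← he1] at hK1 q3 q4
  rw [← he2] at hK2 q1 q2
  have he2η : e2 ≤ η := le_trans (le_mul_of_one_le_left he2p.le hY0) hK2
  refine ⟨(β (j + 1))⁻¹, P.inv_mem (hβP _), ?_⟩
  obtain ⟨g, hg⟩ : ∃ g, g = (β (j + 1))⁻¹ * w := ⟨_, rfl⟩
  rw [← hg]
  have g00 : g 0 0 = β (j + 1) 1 1 * x.1 - β (j + 1) 0 1 * x.2 := by
    rw [hg]
    simp [Matrix.SpecialLinearGroup.coe_mul, Matrix.SpecialLinearGroup.coe_inv, Matrix.adjugate_fin_two, Matrix.mul_apply, Fin.sum_univ_two, hw0, hw1]; ring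
  have g10 : g 1 0 = - β (j + 1) 1 0 * x.1 + β (j + 1) 0 0 * x.2 := by
    rw [hg]
    simp [Matrix.SpecialLinearGroup.coe_mul, Matrix.SpecialLinearGroup.coe_inv, Matrix.adjugate_fin_two, Matrix.mul_apply, Fin.sum_univ_two, hw0, hw1]
  have g01 : g 0 1 = β (j + 1) 1 1 * w 0 1 + - β (j + 1) 0 1 * w 1 1 := by
    rw [hg]
    simp [Matrix.SpecialLinearGroup.coe_mul, Matrix.SpecialLinearGroup.coe_inv, Matrix.adjugate_fin_two, Matrix.mul_apply, Fin.sum_univ_two]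
  have hdet : g 0 0 * g 1 1 - g 0 1 * g 1 0 = 1 := by
    have := g.det_coe
    rwa [Matrix.det_fin_two] at this
  rw [← g00] at q1
  rw [← g10] at q2
  have p00 : |g 0 0 - 1| ≤ η := q1.trans he2η
  have p10 : |g 1 0| * rexp t ≤ η := by
    refine le_trans ?_ (q2.trans he2η)
    gcongr
  have p01 : |g 0 1| ≤ η * rexp t := by
    rw [g01]
    calc _ ≤ |β (j + 1) 1 1 * w 0 1| + |- β (j + 1) 0 1 * w 1 1| := abs_add_le _ _
      _ = |β (j + 1) 1 1| * |w 0 1| + |β (j + 1) 0 1| * |w 1 1| := by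
        rw [abs_mul, abs_mul, abs_neg]
      _ ≤ (e1 * rexp (τ (j + 1))) * |w 0 1| + (e1 * rexp (τ (j + 1))) * |w 1 1| := by gcongr
      _ = ((Y - 1) * e1) * rexp (τ (j + 1)) := by rw [hY]; ring
      _ ≤ (Y * e1) * rexp (τ (j + 1)) := by gcongr; linarith
      _ ≤ η * rexp t := by gcongr
  have pp : |g 0 1 * g 1 0| ≤ η * η := by
    have h := mul_le_mul p01 p10 (by positivity) (by positivity)
    rw [abs_mul]
    have he := Real.exp_pos t
    have : (|g 0 1| * |g 1 0|) * rexp t ≤ (η * η) * rexp t := by linarith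
    exact le_of_mul_le_mul_right this he
  refine ⟨by linarith, by linarith, p01.trans ?_, ?_⟩
  · gcongr; linarith
  · obtain ⟨p, hp⟩ : ∃ p, p = g 0 0 := ⟨_, rfl⟩
    obtain ⟨s, hs⟩ : ∃ p, p = g 1 1 := ⟨_, rfl⟩
    obtain ⟨z, hz⟩ : ∃ p, p = g 0 1 * g 1 0 := ⟨_, rfl⟩
    rw [← hp, ← hs, ← hz] at hdet
    rw [← hz] at pp
    rw [← hp] at p00
    rw [← hs]
    refine le_trans ?_ hη2
    have hpl : 1 / 2 ≤ p := by have := abs_le.1 p00; linarith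
    have e : p * (s - 1) = z - (p - 1) := by linear_combination hdet
    have e2 : |p| * |s - 1| ≤ 2 * η := by
      rw [← abs_mul, e]
      refine (abs_sub _ _).trans ?_
      nlinarith
    rw [abs_of_pos (by linarith)] at e2
    nlinarith [abs_nonneg (s - 1)]

lemma nhds_entries (U : Set SL(2, ℝ))
    (hU : U ∈ @nhds _ Matrix.SpecialLinearGroup.instTopologicalSpace (1 : SL(2, ℝ))) :
    ∃ η > 0, ∀ M : SL(2, ℝ), |M 0 0 - 1| ≤ η → |M 0 1| ≤ η → |M 1 0| ≤ η → |M 1 1 - 1| ≤ η →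
      M ∈ U := by
  have h1 : ∃ W ∈ 𝓝 (1 : Matrix (Fin 2) (Fin 2) ℝ),
      (fun M : SL(2, ℝ) => (M : Matrix (Fin 2) (Fin 2) ℝ)) ⁻¹' W ⊆ U :=
    (mem_nhds_induced _ _ _).1 hU
  obtain ⟨W, hW, hWU⟩ := h1
  obtain ⟨c, hc⟩ : ∃ c : Fin 2 → Fin 2 → ℝ, c = fun i j => if i = j then 1 else 0 := ⟨_, rfl⟩
  have hc1 : (1 : Matrix (Fin 2) (Fin 2) ℝ) = Matrix.of c := by
    ext i j; simp [hc, Matrix.one_apply]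
  have h2 : W ∈ @nhds (Fin 2 → Fin 2 → ℝ) _ c := by
    rw [hc1] at hW; exact hW
  obtain ⟨η, hη, hb⟩ := Metric.nhds_basis_closedBall.mem_iff.1 h2
  refine ⟨η, hη, fun M h00 h01 h10 h11 => hWU (hb ?_)⟩
  change (fun i j => M i j : Fin 2 → Fin 2 → ℝ) ∈ _
  rw [Metric.mem_closedBall, dist_pi_le_iff hη.le]
  intro i
  rw [dist_pi_le_iff hη.le]
  intro j
  rw [Real.dist_eq, hc]
  fin_cases i <;> fin_cases j <;> simpa

lemma discrete_entries (Γ : Subgroup SL(2, ℝ)) (hdisc : DiscreteTopology Γ) (u : SL(2, ℝ)) :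
    ∃ η > 0, ∀ M : SL(2, ℝ), u * M * u⁻¹ ∈ Γ →
      |M 0 0 - 1| ≤ η → |M 0 1| ≤ η → |M 1 0| ≤ η → |M 1 1 - 1| ≤ η → M = 1 := by
  have h1 : ({1} : Set Γ) ∈ 𝓝 (1 : Γ) := (isOpen_discrete _).mem_nhds rfl
  obtain ⟨U, hU, hUs⟩ := (mem_nhds_induced _ _ _).1 h1
  have hU' : U ∈ @nhds _ Matrix.SpecialLinearGroup.instTopologicalSpace (1 : SL(2, ℝ)) := hU
  have hc : @Continuous _ _ Matrix.SpecialLinearGroup.instTopologicalSpace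
      Matrix.SpecialLinearGroup.instTopologicalSpace (fun M : SL(2, ℝ) => u * M * u⁻¹) := by
    let _ := @Matrix.SpecialLinearGroup.instTopologicalSpace (Fin 2) ℝ _ _ _ _
    fun_prop
  have hpre := (@Continuous.continuousAt _ _ Matrix.SpecialLinearGroup.instTopologicalSpace
    Matrix.SpecialLinearGroup.instTopologicalSpace _ 1 hc).preimage_mem_nhds
      (t := U) (by simpa using hU')
  obtain ⟨η, hη, h⟩ := nhds_entries _ hpre
  refine ⟨η, hη, fun M hM h00 h01 h10 h11 => ?_⟩
  have h3 := h M h00 h01 h10 h11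
  have h4 : (⟨_, hM⟩ : Γ) ∈ ({1} : Set Γ) := hUs h3
  have h5 : u * M * u⁻¹ = 1 := congrArg Subtype.val h4
  have : M = u⁻¹ * (u * M * u⁻¹) * u := by group
  rw [this, h5]; group

lemma countable_of_discrete (Γ : Subgroup SL(2, ℝ)) (hdisc : DiscreteTopology Γ) :
    Countable Γ := by
  have h : IsInducing (fun g : Γ => (fun i j => (g : SL(2, ℝ)) i j : Fin 2 → Fin 2 → ℝ)) := by
    constructor
    rw [instTopologicalSpaceSubtype]
    exact induced_compose
  have := h.secondCountableTopology
  exact TopologicalSpace.separableSpace_iff_countable.1 inferInstance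

lemma d1_mul_left (u g h : SL(2, ℝ)) : d1 (u * g) (u * h) = d1 g h := by
  unfold d1
  simp only [mul_smul, dist_smul]

lemma conj_A (t : ℝ) (g : SL(2, ℝ)) :
    ((A t)⁻¹ * (g * A t)) 0 0 = g 0 0 ∧ ((A t)⁻¹ * (g * A t)) 1 1 = g 1 1 ∧
    ((A t)⁻¹ * (g * A t)) 0 1 = rexp (-t) * g 0 1 ∧
    ((A t)⁻¹ * (g * A t)) 1 0 = rexp t * g 1 0 := by
  have e1 : rexp t = rexp (t / 2) * rexp (t / 2) := by rw [← Real.exp_add]; ring_nf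
  have e2 : rexp (-t) = rexp (-(t / 2)) * rexp (-(t / 2)) := by rw [← Real.exp_add]; ring_nf
  have e3 : rexp (t / 2) * rexp (-(t / 2)) = 1 := by rw [← Real.exp_add]; simp
  have a00 : A t 0 0 = rexp (t / 2) := rfl
  have a01 : A t 0 1 = 0 := rfl
  have a10 : A t 1 0 = 0 := rfl
  have a11 : A t 1 1 = rexp (-(t / 2)) := rfl
  rw [e1, e2]
  refine ⟨?_, ?_, ?_, ?_⟩ <;>
    simp [Matrix.SpecialLinearGroup.coe_mul, Matrix.SpecialLinearGroup.coe_inv,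
      Matrix.adjugate_fin_two, Matrix.mul_apply, Fin.sum_univ_two, a00, a01, a10, a11]
  · linear_combination (g 0 0) * e3
  · linear_combination (g 1 1) * e3
  · ring
  · ring

lemma d1_near (ε : ℝ) (hε : 0 < ε) :
    ∃ η > 0, ∀ (t : ℝ) (g : SL(2, ℝ)), Near η t g → d1 (A t) (g * A t) < ε := by
  have hU : {M : SL(2, ℝ) | d1 1 M < ε} ∈
      @nhds _ Matrix.SpecialLinearGroup.instTopologicalSpace (1 : SL(2, ℝ)) := by
    have hc : @Continuous _ _ Matrix.SpecialLinearGroup.instTopologicalSpace _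
        (fun M : SL(2, ℝ) => d1 1 M) := by
      let _ := @Matrix.SpecialLinearGroup.instTopologicalSpace (Fin 2) ℝ _ _ _ _
      unfold d1
      fun_prop
    apply (@Continuous.continuousAt _ _ Matrix.SpecialLinearGroup.instTopologicalSpace _ _ 1
      hc).preimage_mem_nhds (t := Set.Iio ε)
    apply Iio_mem_nhds
    simpa [d1] using hε
  obtain ⟨η, hη, h⟩ := nhds_entries _ hU
  refine ⟨η, hη, fun t g hg => ?_⟩
  obtain ⟨h00, h10, h01, h11⟩ := hg
  have e : d1 (A t) (g * A t) = d1 1 ((A t)⁻¹ * (g * A t)) := by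
    rw [← d1_mul_left (A t)⁻¹]; simp
  rw [e]
  obtain ⟨k00, k11, k01, k10⟩ := conj_A t g
  have he := Real.exp_pos t
  apply h
  · rwa [k00]
  · rw [k01, abs_mul, abs_of_pos (Real.exp_pos _), Real.exp_neg]
    rw [inv_mul_le_iff₀ he]; linarith
  · rw [k10, abs_mul, abs_of_pos he]; linarith
  · rwa [k11]

lemma A_smul (t : ℝ) : A t • vray 0 = vray t := by
  have e3 : rexp (-(t / 2)) * rexp t = rexp (t / 2) := by rw [← Real.exp_add]; ring_nf
  have e4 : (rexp (-(t / 2)) : ℂ) ≠ 0 := by exact_mod_cast (Real.exp_pos _).ne'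
  apply UpperHalfPlane.ext
  have hv : ∀ s, (vray s : ℂ) = (rexp s : ℂ) * Complex.I := by
    intro s
    apply Complex.ext <;> simp [vray, -Complex.ofReal_exp]
  rw [UpperHalfPlane.coe_specialLinearGroup_apply, hv, hv]
  change ((rexp (t / 2) : ℂ) * ((rexp 0 : ℂ) * Complex.I) + ((0 : ℝ) : ℂ)) /
    (((0 : ℝ) : ℂ) * ((rexp 0 : ℂ) * Complex.I) + (rexp (-(t / 2)) : ℂ)) = _
  rw [← e3, div_eq_iff (by simp), Real.exp_zero]
  push_cast
  ring

lemma cosh_disp (E : SL(2, ℝ)) : 2 * Real.cosh (dist (vray 0) (E • vray 0)) =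
    E 0 0 ^ 2 + E 0 1 ^ 2 + E 1 0 ^ 2 + E 1 1 ^ 2 := by
  have hdet : E 0 0 * E 1 1 - E 0 1 * E 1 0 = 1 := by
    have := E.det_coe
    rwa [Matrix.det_fin_two] at this
  have hv : (vray 0 : ℂ) = Complex.I := by
    apply Complex.ext <;> simp [vray]
  have hco := UpperHalfPlane.coe_specialLinearGroup_apply E (vray 0)
  rw [hv] at hco
  generalize E • vray 0 = z at *
  obtain ⟨a, ha⟩ : ∃ a, a = E 0 0 := ⟨_, rfl⟩
  obtain ⟨b, hb⟩ : ∃ a, a = E 0 1 := ⟨_, rfl⟩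
  obtain ⟨c, hc⟩ : ∃ a, a = E 1 0 := ⟨_, rfl⟩
  obtain ⟨d, hd⟩ : ∃ a, a = E 1 1 := ⟨_, rfl⟩
  rw [← ha, ← hb, ← hc, ← hd] at hdet hco ⊢
  clear ha hb hc hd
  have hq : c ^ 2 + d ^ 2 ≠ 0 := by
    intro h
    have h1 : c = 0 := by nlinarith [sq_nonneg c, sq_nonneg d]
    have h2 : d = 0 := by nlinarith [sq_nonneg c, sq_nonneg d]
    simp [h1, h2] at hdet
  have hq1 : d * d + c * c ≠ 0 := by intro h; apply hq; linarith
  have hq2 : d ^ 2 + c ^ 2 ≠ 0 := by intro h; apply hq; linarith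
  have hre : z.re = (a * c + b * d) / (c ^ 2 + d ^ 2) := by
    rw [← UpperHalfPlane.coe_re, hco]
    simp [Complex.div_re, Complex.normSq_apply]
    field_simp
    ring
  have him : z.im = 1 / (c ^ 2 + d ^ 2) := by
    rw [← UpperHalfPlane.coe_im, hco]
    simp [Complex.div_im, Complex.normSq_apply]
    field_simp
    linear_combination (d ^ 2 + c ^ 2) * hdet
  have hv1 : (vray 0).im = 1 := by simp [vray, UpperHalfPlane.im]
  have hv0 : (vray 0).re = 0 := by simp [vray, UpperHalfPlane.re]
  rw [UpperHalfPlane.cosh_dist', hv1, hv0, hre, him]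
  field_simp
  linear_combination (-(a*d-b*c+1)) * hdet

set_option maxHeartbeats 1000000 in
lemma near_sq (a b c d σ : ℝ) (hσ0 : 0 < σ) (hσ : σ ≤ 1) (hdet : a * d - b * c = 1)
    (htr : 4 < (a + d) ^ 2) (hs : a ^ 2 + b ^ 2 + c ^ 2 + d ^ 2 ≤ 2 + σ ^ 2) :
    |a * a + b * c - 1| ≤ 4 * σ ∧ |a * b + b * d| ≤ 4 * σ ∧ |c * a + d * c| ≤ 4 * σ ∧
    |c * b + d * d - 1| ≤ 4 * σ := by
  have h1 : |a - d| ≤ σ := abs_le_of_sq_le_sq (by nlinarith [sq_nonneg (b + c)]) hσ0.le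
  have h2 : |b + c| ≤ σ := abs_le_of_sq_le_sq (by nlinarith [sq_nonneg (a - d)]) hσ0.le
  have h3 : |b - c| ≤ σ := abs_le_of_sq_le_sq (by nlinarith) hσ0.le
  have hb : |b| ≤ σ := by
    rw [abs_le] at *; constructor <;> linarith [h2.1, h2.2, h3.1, h3.2]
  have hc : |c| ≤ σ := by
    rw [abs_le] at *; constructor <;> linarith [h2.1, h2.2, h3.1, h3.2]
  have ha : |a| ≤ 2 := abs_le_of_sq_le_sq (by nlinarith [sq_nonneg b, sq_nonneg c, sq_nonneg d])
    (by norm_num)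
  have hd : |d| ≤ 2 := abs_le_of_sq_le_sq (by nlinarith [sq_nonneg b, sq_nonneg c, sq_nonneg a])
    (by norm_num)
  have hbc : |b| * |c| ≤ σ := by
    calc |b| * |c| ≤ σ * σ := by gcongr
      _ ≤ σ := by nlinarith
  have hda : |d - a| ≤ σ := by rwa [abs_sub_comm]
  have k1 : |a| * |a - d| ≤ 2 * σ := by gcongr
  have k2 : |d| * |d - a| ≤ 2 * σ := by gcongr
  have k3 : |a + d| ≤ 4 := (abs_add_le _ _).trans (by linarith)
  refine ⟨?_, ?_, ?_, ?_⟩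
  · rw [show a * a + b * c - 1 = a * (a - d) + 2 * (b * c) by linear_combination hdet]
    refine (abs_add_le _ _).trans ?_
    rw [abs_mul, abs_mul, abs_mul, abs_two]; linarith
  · rw [show a * b + b * d = (a + d) * b by ring, abs_mul]; gcongr
  · rw [show c * a + d * c = (a + d) * c by ring, abs_mul]; gcongr
  · rw [show c * b + d * d - 1 = d * (d - a) + 2 * (b * c) by linear_combination hdet]
    refine (abs_add_le _ _).trans ?_
    rw [abs_mul, abs_mul, abs_mul, abs_two]; linarith

set_option maxHeartbeats 1000000 in
lemma exists_near (Γ : Subgroup SL(2, ℝ)) (hdisc : DiscreteTopology Γ)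
    (u : SL(2, ℝ)) (γ : ℕ → SL(2, ℝ)) (hmem : ∀ n, γ n ∈ Γ)
    (hhyp : ∀ n, IsHyperbolic (γ n))
    (hmeet : ∀ n, ∃ t : ℝ, 0 ≤ t ∧ (u • vray t : ℍ) ∈ Axis (γ n))
    (hlen : Tendsto (fun n => transLength (γ n)) atTop (nhds 0)) :
    ∀ ε > 0, ∀ T : ℝ, ∃ g ∈ Γ.comap (MulAut.conj u).toMonoidHom, ∃ t ≥ T,
      (g 0 0, g 1 0) ≠ ((1, 0) : ℝ × ℝ) ∧ Near ε t g := by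
  intro ε hε T
  obtain ⟨η, hη, hdis⟩ := discrete_entries Γ hdisc u
  obtain ⟨σ, hσ0, hσ1, hσε, hση⟩ : ∃ σ : ℝ, 0 < σ ∧ σ ≤ 1 ∧ 4 * σ ≤ ε ∧
      4 * σ * rexp |T| ≤ η := by
    refine ⟨min 1 (min (ε / 4) (η / (4 * rexp |T|))), by positivity, min_le_left _ _, ?_, ?_⟩
    · have : min 1 (min (ε / 4) (η / (4 * rexp |T|))) ≤ ε / 4 :=
        (min_le_right _ _).trans (min_le_left _ _)
      linarith
    · have : min 1 (min (ε / 4) (η / (4 * rexp |T|))) ≤ η / (4 * rexp |T|) :=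
        (min_le_right _ _).trans (min_le_right _ _)
      rw [le_div_iff₀ (by positivity)] at this
      linarith
  have hcosh : Tendsto (fun n => 2 * Real.cosh (transLength (γ n))) atTop (nhds (2 * 1)) := by
    rw [← Real.cosh_zero]
    exact ((Real.continuous_cosh.tendsto 0).comp hlen).const_mul 2
  obtain ⟨n, hn⟩ := (hcosh.eventually (gt_mem_nhds
    (show (2 * 1 : ℝ) < 2 + σ ^ 2 by nlinarith))).exists
  obtain ⟨t, ht0, hax⟩ := hmeet n
  obtain ⟨h, hh⟩ : ∃ h, h = u⁻¹ * γ n * u := ⟨_, rfl⟩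
  obtain ⟨E, hE⟩ : ∃ E, E = (A t)⁻¹ * (h * A t) := ⟨_, rfl⟩
  have hdist : dist (vray 0) (E • vray 0) = transLength (γ n) := by
    have h1 : dist (u • vray t) (γ n • (u • vray t)) = transLength (γ n) := hax
    rw [← h1, ← A_smul t, hE, hh, ← dist_smul (u * A t) (vray 0)]
    congr 1
    · rw [mul_smul]
    · simp only [← mul_smul]; congr 1; group
  have hcd := cosh_disp E
  rw [hdist] at hcd
  have hdetE : E 0 0 * E 1 1 - E 0 1 * E 1 0 = 1 := by
    have := E.det_coe
    rwa [Matrix.det_fin_two] at this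
  obtain ⟨k00, k11, k01, k10⟩ := conj_A t h
  rw [← hE] at k00 k11 k01 k10
  have htr : E 0 0 + E 1 1 = Matrix.trace (γ n : Matrix (Fin 2) (Fin 2) ℝ) := by
    rw [k00, k11, ← Matrix.trace_fin_two, hh, mul_assoc, Matrix.SpecialLinearGroup.coe_mul,
      Matrix.trace_mul_comm, ← Matrix.SpecialLinearGroup.coe_mul,
      mul_inv_cancel_right]
  have htr4 : 4 < (E 0 0 + E 1 1) ^ 2 := by
    have h1 : 2 < |Matrix.trace (γ n : Matrix (Fin 2) (Fin 2) ℝ)| := hhyp n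
    rw [htr, ← sq_abs]; nlinarith
  obtain ⟨n00, n01, n10, n11⟩ := near_sq _ _ _ _ σ hσ0 hσ1 hdetE htr4 (by linarith)
  obtain ⟨g, hg⟩ : ∃ g, g = h * h := ⟨_, rfl⟩
  have g00 : g 0 0 = h 0 0 * h 0 0 + h 0 1 * h 1 0 := by
    simp [hg, Matrix.mul_apply, Fin.sum_univ_two]
  have g01 : g 0 1 = h 0 0 * h 0 1 + h 0 1 * h 1 1 := by
    simp [hg, Matrix.mul_apply, Fin.sum_univ_two]
  have g10 : g 1 0 = h 1 0 * h 0 0 + h 1 1 * h 1 0 := by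
    simp [hg, Matrix.mul_apply, Fin.sum_univ_two]
  have g11 : g 1 1 = h 1 0 * h 0 1 + h 1 1 * h 1 1 := by
    simp [hg, Matrix.mul_apply, Fin.sum_univ_two]
  have hee : rexp (-t) * rexp t = 1 := by rw [← Real.exp_add]; simp
  rw [k00, k01, k10, show h 0 0 * h 0 0 + rexp (-t) * h 0 1 * (rexp t * h 1 0) - 1 = g 0 0 - 1 by
    rw [g00]; linear_combination (h 0 1 * h 1 0) * hee] at n00
  rw [k11, k01, k10, show rexp t * h 1 0 * (rexp (-t) * h 0 1) + h 1 1 * h 1 1 - 1 = g 1 1 - 1 by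
    rw [g11]; linear_combination (h 0 1 * h 1 0) * hee] at n11
  rw [k00, k11, k01, show h 0 0 * (rexp (-t) * h 0 1) + rexp (-t) * h 0 1 * h 1 1 =
    rexp (-t) * g 0 1 by rw [g01]; ring, abs_mul, abs_of_pos (Real.exp_pos _), Real.exp_neg,
    inv_mul_le_iff₀ (Real.exp_pos t)] at n01
  rw [k00, k11, k10, show rexp t * h 1 0 * h 0 0 + h 1 1 * (rexp t * h 1 0) =
    rexp t * g 1 0 by rw [g10]; ring, abs_mul, abs_of_pos (Real.exp_pos _)] at n10
  have hgΓ : u * g * u⁻¹ ∈ Γ := by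
    have : u * g * u⁻¹ = γ n * γ n := by rw [hg, hh]; group
    rw [this]; exact Γ.mul_mem (hmem n) (hmem n)
  have hne : (g 0 0, g 1 0) ≠ ((1, 0) : ℝ × ℝ) := by
    intro hcon
    rw [Prod.mk.injEq] at hcon
    have hdetg : g 0 0 * g 1 1 - g 0 1 * g 1 0 = 1 := by
      have := g.det_coe
      rwa [Matrix.det_fin_two] at this
    rw [hcon.1, hcon.2] at hdetg
    have hdeth : h 0 0 * h 1 1 - h 0 1 * h 1 0 = 1 := by
      have := h.det_coe
      rwa [Matrix.det_fin_two] at this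
    rw [k00, k11] at htr4
    have h1 := hcon.1
    nlinarith
  refine ⟨g, hgΓ, t, ?_, hne, by linarith, by linarith, ?_, by linarith⟩
  · by_contra hlt
    apply hne
    have h1 : 1 ≤ rexp t := Real.one_le_exp ht0
    have h2 : rexp t ≤ rexp |T| := Real.exp_le_exp.2 (by have := le_abs_self T; linarith)
    have h3 : 4 * σ ≤ η := le_trans (le_mul_of_one_le_right (by positivity) (h1.trans h2)) hση
    have : g = 1 := by
      apply hdis g hgΓ (n00.trans h3) ?_ ?_ (n11.trans h3)
      · refine n01.trans (le_trans ?_ hση)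
        rw [mul_comm]
        gcongr
      · exact (le_mul_of_one_le_left (abs_nonneg _) h1).trans (n10.trans h3)
    rw [this]; simp
  · refine n01.trans ?_
    rw [mul_comm]
    gcongr

lemma N_mul (s s' : ℝ) : N s * N s' = N (s + s') := by
  apply Subtype.ext
  change !![1, s; 0, 1] * !![1, s'; 0, 1] = !![1, s + s'; 0, 1]
  simp [add_comm]

lemma N_zero : N 0 = 1 := by
  ext i j
  fin_cases i <;> fin_cases j <;> simp [N]

lemma mul_N_col (g : SL(2, ℝ)) (s : ℝ) : (g * N s) 0 0 = g 0 0 ∧ (g * N s) 1 0 = g 1 0 := by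
  have a00 : N s 0 0 = 1 := rfl
  have a10 : N s 1 0 = 0 := rfl
  constructor <;> simp [Matrix.SpecialLinearGroup.coe_mul, Matrix.mul_apply, Fin.sum_univ_two,
    a00, a10]

/-- Lying on the same horocyclic orbit in the quotient. -/
def HRel (Γ : Subgroup SL(2, ℝ)) (w w' : SL(2, ℝ)) : Prop :=
  ∃ δ ∈ Γ, ∃ s : ℝ, ∃ ε : SL(2, ℝ), (ε = 1 ∨ ε = -1) ∧ w' = ε * (δ * w * N s)

lemma HRel.refl (Γ : Subgroup SL(2, ℝ)) (w : SL(2, ℝ)) : HRel Γ w w :=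
  ⟨1, Γ.one_mem, 0, 1, Or.inl rfl, by simp [N_zero]⟩

lemma HRel.symm {Γ : Subgroup SL(2, ℝ)} {w w' : SL(2, ℝ)} (h : HRel Γ w w') : HRel Γ w' w := by
  obtain ⟨δ, hδ, s, ε, hε, rfl⟩ := h
  refine ⟨δ⁻¹, Γ.inv_mem hδ, -s, ε, hε, ?_⟩
  have hN : N s * N (-s) = 1 := by rw [N_mul]; simp [N_zero]
  rcases hε with rfl | rfl <;> simp [mul_assoc, hN]

lemma HRel.trans {Γ : Subgroup SL(2, ℝ)} {w w' w'' : SL(2, ℝ)} (h : HRel Γ w w')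
    (h' : HRel Γ w' w'') : HRel Γ w w'' := by
  obtain ⟨δ, hδ, s, ε, hε, rfl⟩ := h
  obtain ⟨δ', hδ', s', ε', hε', rfl⟩ := h'
  refine ⟨δ' * δ, Γ.mul_mem hδ' hδ, s + s', ε' * ε, ?_, ?_⟩
  · rcases hε with rfl | rfl <;> rcases hε' with rfl | rfl <;> simp
  · rw [← N_mul]
    rcases hε with rfl | rfl <;> rcases hε' with rfl | rfl <;> simp [mul_assoc]

theorem strong_stable_uncountably_many_horocycles
    (Γ : Subgroup SL(2, ℝ)) (hdisc : DiscreteTopology Γ)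
    (htf : ∀ γ ∈ Γ, ∀ n : ℕ, 0 < n → γ ^ n = 1 → γ = 1)
    (hneg : (-1 : SL(2, ℝ)) ∉ Γ)
    (u : SL(2, ℝ)) (γ : ℕ → SL(2, ℝ)) (hmem : ∀ n, γ n ∈ Γ)
    (hhyp : ∀ n, IsHyperbolic (γ n))
    (hmeet : ∀ n, ∃ t : ℝ, 0 ≤ t ∧ (u • vray t : ℍ) ∈ Axis (γ n))
    (hlen : Tendsto (fun n => transLength (γ n)) atTop (nhds 0)) :
    ∃ V : Set SL(2, ℝ), ¬ V.Countable ∧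
      (∀ w ∈ V,
        Tendsto (fun t : ℝ => ⨅ δ : Γ, d1 (u * A t) ((δ : SL(2, ℝ)) * (w * A t)))
          atTop (nhds 0)) ∧
      ∀ w ∈ V, ∀ w' ∈ V, w ≠ w' →
        ∀ δ ∈ Γ, ∀ s : ℝ, ∀ ε : SL(2, ℝ), (ε = 1 ∨ ε = -1) →
          w' ≠ ε * (δ * w * N s) := by
  have H := exists_near Γ hdisc u γ hmem hhyp hmeet hlen
  have hcount := countable_of_discrete Γ hdisc
  obtain ⟨G, hG⟩ : ∃ G : Set SL(2, ℝ), G = {w |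
    Tendsto (fun t : ℝ => ⨅ δ : Γ, d1 (u * A t) ((δ : SL(2, ℝ)) * (w * A t)))
          atTop (nhds 0)} := ⟨_, rfl⟩
  have hG' : ∀ w ∈ G, Tendsto (fun t : ℝ => ⨅ δ : Γ, d1 (u * A t) ((δ : SL(2, ℝ)) * (w * A t)))
      atTop (nhds 0) := by
    intro w hw
    rw [hG] at hw
    exact hw
  let st : Setoid G :=
    { r := fun a b => HRel Γ a.1 b.1
      iseqv := ⟨fun a => HRel.refl Γ a.1, fun h => h.symm, fun h h' => h.trans h'⟩ }
  refine ⟨Set.range (fun q : Quotient st => (q.out : SL(2, ℝ))), ?_, ?_, ?_⟩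
  · intro hV
    have hC : (Set.insert (0 : ℝ × ℝ)
        ((fun p : SL(2, ℝ) × SL(2, ℝ) × SL(2, ℝ) =>
        (((u⁻¹ * (p.1 * (p.2.1 * p.2.2))) 0 0, (u⁻¹ * (p.1 * (p.2.1 * p.2.2))) 1 0) : ℝ × ℝ)) ''
        (({1, -1} : Set SL(2, ℝ)) ×ˢ ((Γ : Set SL(2, ℝ)) ×ˢ
          (Set.range (fun q : Quotient st => (q.out : SL(2, ℝ)))))))).Countable := by
      apply Set.Countable.insert
      apply Set.Countable.image
      apply Set.Countable.prod
      · exact (Set.toFinite _).countable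
      · exact Set.Countable.prod (Set.countable_coe_iff.1 hcount) hV
    obtain ⟨v, hv⟩ := hC.exists_eq_range ⟨0, Set.mem_insert _ _⟩
    obtain ⟨w, hwv, hw⟩ := core _ H v
    have hwG : u * w ∈ G := by
      rw [hG, Set.mem_ofPred_eq, Metric.tendsto_atTop]
      intro ε hε
      obtain ⟨η, hη, hd⟩ := d1_near ε hε
      obtain ⟨T, hT⟩ := hw η hη
      refine ⟨T, fun t ht => ?_⟩
      obtain ⟨δ, hδ, hnear⟩ := hT t ht
      have hd' := hd t _ hnear
      have hδΓ : u * δ * u⁻¹ ∈ Γ := hδ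
      have hnn : ∀ δ' : Γ, 0 ≤ d1 (u * A t) ((δ' : SL(2, ℝ)) * (u * w * A t)) := by
        intro δ'; unfold d1; positivity
      have hle : (⨅ δ' : Γ, d1 (u * A t) ((δ' : SL(2, ℝ)) * (u * w * A t))) ≤
          d1 (u * A t) ((u * δ * u⁻¹) * (u * w * A t)) :=
        ciInf_le ⟨0, by rintro _ ⟨δ', rfl⟩; exact hnn δ'⟩ (⟨_, hδΓ⟩ : Γ)
      rw [show (u * δ * u⁻¹) * (u * w * A t) = u * (δ * w * A t) by group, d1_mul_left] at hle
      rw [Real.dist_eq, sub_zero, abs_of_nonneg (Real.iInf_nonneg hnn)]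
      exact lt_of_le_of_lt hle hd'
    have hrel : HRel Γ (Quotient.mk st ⟨u * w, hwG⟩).out.1 (u * w) :=
      Quotient.exact (Quotient.out_eq (Quotient.mk st ⟨u * w, hwG⟩))
    obtain ⟨δ, hδ, s, ε, hε, heq⟩ := hrel
    obtain ⟨w', hw'⟩ : ∃ w', w' = (Quotient.mk st ⟨u * w, hwG⟩).out.1 := ⟨_, rfl⟩
    rw [← hw'] at heq
    have hmemC : ((w 0 0, w 1 0) : ℝ × ℝ) ∈ Set.range v := by
      rw [← hv]
      apply Set.mem_insert_of_mem
      refine ⟨(ε, δ, w'), ⟨by simpa using hε, hδ, ⟨_, hw'.symm⟩⟩, ?_⟩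
      have hww : w = (u⁻¹ * (ε * (δ * w'))) * N s := by
        have : w = u⁻¹ * (u * w) := by group
        rw [this, heq]; group
      obtain ⟨c0, c1⟩ := mul_N_col (u⁻¹ * (ε * (δ * w'))) s
      rw [← hww] at c0 c1
      rw [c0, c1]
    obtain ⟨k, hk⟩ := hmemC
    exact hwv k hk.symm
  · rintro _ ⟨q, rfl⟩
    exact hG' _ q.out.2
  · rintro _ ⟨q, rfl⟩ _ ⟨q', rfl⟩ hne δ hδ s ε hε heq
    apply hne
    have : q = q' := by
      rw [← Quotient.out_eq q, ← Quotient.out_eq q']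
      exact Quotient.sound ⟨δ, hδ, s, ε, hε, heq⟩
    rw [this]

end BellisFormal
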